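/- Let G be an abelian group with no elements of order 2. For any odd n ≥ 3, any α, β ∈ (ℤ/nℤ)^×, and any injective group homomorphism ι : ℤ/nℤ → G, there exists s ∈ G such that FS(ι(αU_n)) = FS(ι(βU_n)) + s. -/

import Mathlib

open scoped BigOperators

/-- The multiset of all `2^|A|` subset sums of a finite multiset `A`. -/
def FS {G : Type*} [AddCommMonoid G] (A : Multiset G) : Multiset G :=
  A.powerset.map Multiset.sum

/-- The minimal `k ≥ 1` such that `2^k ≡ ±1 (mod n)`. -/
noncomputable def Upow (n : ℕ) : ℕ :=
  sInf {k : ℕ | 1 ≤ k ∧ ((2 : ZMod n) ^ k = 1 ∨ (2 : ZMod n) ^ k = -1)}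

/-- The set `U_n = {1, 2, 4, …, 2^{k-1}} ⊆ ℤ/nℤ`. -/
noncomputable def Uset (n : ℕ) : Finset (ZMod n) :=
  (Finset.range (Upow n)).image (fun i => (2 : ZMod n) ^ i)

/-- The multiset `ι(α U_n)` inside `G`. -/
noncomputable def UMultiset {G : Type*} [AddCommGroup G] (n : ℕ) (α : (ZMod n)ˣ)
    (ι : ZMod n →+ G) : Multiset G :=
  (Uset n).val.map (fun u => ι ((α : ZMod n) * u))

theorem FS_cons {G : Type*} [AddCommMonoid G] (a : G) (A : Multiset G) :
    FS (a ::ₘ A) = FS A + (FS A).map (fun x => a + x) := by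
  simp [FS, Multiset.powerset_cons, Multiset.map_map]

theorem FS_map_two_pow {G R : Type*} [AddCommMonoid G] [CommRing R] (f : R →+ G) (k : ℕ) :
    FS ((Multiset.range k).map (fun i => f (2 ^ i))) =
      (Multiset.range (2 ^ k)).map (fun m : ℕ => f (m : R)) := by
  induction k with
  | zero => simp [FS, show Multiset.range 1 = {0} from rfl]
  | succ k ih =>
    rw [Multiset.range_succ, Multiset.map_cons, FS_cons, ih, pow_succ, mul_two,
      Multiset.range_add, Multiset.map_add, Multiset.map_map, Multiset.map_map]
    simp

theorem Upow_spec {n : ℕ} (hn : Odd n) :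
    1 ≤ Upow n ∧ ((2 : ZMod n) ^ Upow n = 1 ∨ (2 : ZMod n) ^ Upow n = -1) := by
  have hpos : 0 < n := hn.pos
  refine Nat.sInf_mem (s := {k : ℕ | 1 ≤ k ∧ ((2 : ZMod n) ^ k = 1 ∨ (2 : ZMod n) ^ k = -1)})
    ⟨n.totient, Nat.totient_pos.2 hpos, Or.inl ?_⟩
  have h := (ZMod.natCast_eq_natCast_iff _ _ _).2
    (Nat.ModEq.pow_totient (Nat.coprime_two_left.2 hn))
  simpa using h

theorem Uset_val {n : ℕ} (hn : Odd n) :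
    (Uset n).val = (Multiset.range (Upow n)).map (fun i => (2 : ZMod n) ^ i) := by
  have hu : IsUnit (2 : ZMod n) := by
    simpa using (ZMod.isUnit_iff_coprime 2 n).2 (Nat.coprime_two_left.2 hn)
  have key : ∀ i j : ℕ, i < j → j < Upow n → (2 : ZMod n) ^ i ≠ 2 ^ j := by
    intro i j hij hj h
    have h1 : (2 : ZMod n) ^ (j - i) = 1 := by
      apply (hu.pow i).mul_left_cancel
      rw [← pow_add, Nat.add_sub_cancel' hij.le, mul_one, h]
    have h2 : Upow n ≤ j - i := Nat.sInf_le ⟨by omega, Or.inl h1⟩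
    omega
  unfold Uset
  rw [Finset.image_val_of_injOn]
  · rfl
  · intro i hi j hj h
    simp only [Finset.coe_range, Set.mem_Iio] at hi hj
    rcases lt_trichotomy i j with hij | hij | hij
    · exact (key i j hij hj h).elim
    · exact hij
    · exact (key j i hij hi h.symm).elim

theorem map_cast_range_mul (n : ℕ) [NeZero n] (c : ℕ) :
    (Multiset.range (c * n)).map (fun m : ℕ => (m : ZMod n)) =
      c • (Finset.univ : Finset (ZMod n)).val := by
  have hbase : (Multiset.range n).map (fun m : ℕ => (m : ZMod n)) =
      (Finset.univ : Finset (ZMod n)).val := by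
    refine (Multiset.Nodup.ext ?_ Finset.univ.nodup).2 fun x => ?_
    · refine Multiset.Nodup.map_on ?_ (Multiset.nodup_range n)
      intro a ha b hb h
      rw [Multiset.mem_range] at ha hb
      exact Nat.ModEq.eq_of_lt_of_lt ((ZMod.natCast_eq_natCast_iff _ _ _).1 h) ha hb
    · simp only [Multiset.mem_map, Multiset.mem_range, Finset.mem_val, Finset.mem_univ, iff_true]
      exact ⟨x.val, ZMod.val_lt x, ZMod.natCast_zmod_val x⟩
  induction c with
  | zero => simp
  | succ c ih =>
    rw [add_mul, one_mul, Multiset.range_add, Multiset.map_add, ih, Multiset.map_map, succ_nsmul,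
      ← hbase]
    simp

theorem map_nsmul_univ {α : Type*} [Fintype α] (e : α ≃ α) (c : ℕ) :
    (c • (Finset.univ : Finset α).val).map e = c • (Finset.univ : Finset α).val := by
  rw [Multiset.map_nsmul, Multiset.map_univ_val_equiv]

theorem exists_map_range_two_pow_eq {n : ℕ} [NeZero n] {k : ℕ}
    (hk : (2 : ZMod n) ^ k = 1 ∨ (2 : ZMod n) ^ k = -1) (α β : (ZMod n)ˣ) :
    ∃ s : ZMod n, (Multiset.range (2 ^ k)).map (fun m : ℕ => (α : ZMod n) * (m : ZMod n)) =
      (Multiset.range (2 ^ k)).map (fun m : ℕ => (β : ZMod n) * (m : ZMod n) + s) := by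
  rcases hk with hk | hk
  · obtain ⟨m, hm⟩ : ∃ m, 2 ^ k = m + 1 :=
      ⟨2 ^ k - 1, (Nat.sub_add_cancel Nat.one_le_two_pow).symm⟩
    have hm0 : (m : ZMod n) = 0 := by
      have h : ((2 ^ k : ℕ) : ZMod n) = ((m + 1 : ℕ) : ZMod n) := by rw [hm]
      push_cast at h
      rw [hk] at h
      simpa using h
    obtain ⟨c, hc⟩ := (ZMod.natCast_eq_zero_iff m n).1 hm0
    have hM (γ : (ZMod n)ˣ) : (Multiset.range m).map (fun m : ℕ => (γ : ZMod n) * (m : ZMod n)) =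
        c • (Finset.univ : Finset (ZMod n)).val := by
      rw [← map_nsmul_univ (Units.mulLeft γ) c, ← map_cast_range_mul, Multiset.map_map, hc,
        mul_comm n c]
      rfl
    refine ⟨0, ?_⟩
    simp only [hm, add_zero, Multiset.range_succ, Multiset.map_cons, hm0, mul_zero, hM]
  · have h0 : ((2 ^ k + 1 : ℕ) : ZMod n) = 0 := by
      push_cast
      rw [hk, neg_add_cancel]
    obtain ⟨c, hc⟩ := (ZMod.natCast_eq_zero_iff _ n).1 h0
    have hM (e : ZMod n ≃ ZMod n) :
        e (-1) ::ₘ (Multiset.range (2 ^ k)).map (fun m : ℕ => e (m : ZMod n)) =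
          c • (Finset.univ : Finset (ZMod n)).val := by
      rw [← map_nsmul_univ e c, ← map_cast_range_mul, Multiset.map_map, mul_comm c n, ← hc,
        Multiset.range_succ, Multiset.map_cons]
      simp [hk]
    refine ⟨(β : ZMod n) - α, ?_⟩
    have h := (hM (Units.mulLeft α)).trans
      (hM ((Units.mulLeft β).trans (Equiv.addRight ((β : ZMod n) - α)))).symm
    have hs : -(β : ZMod n) + (β - α) = -α := by ring
    simpa [hs] using h

theorem FS_UMultiset {G : Type*} [AddCommGroup G] {n : ℕ} (hn : Odd n) (α : (ZMod n)ˣ)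
    (ι : ZMod n →+ G) :
    FS (UMultiset n α ι) =
      (Multiset.range (2 ^ Upow n)).map (fun m : ℕ => ι ((α : ZMod n) * (m : ZMod n))) := by
  rw [UMultiset, Uset_val hn, Multiset.map_map]
  exact FS_map_two_pow (ι.comp (AddMonoidHom.mulLeft (α : ZMod n))) (Upow n)

theorem stmt12 {G : Type*} [AddCommGroup G] (h2 : ∀ g : G, g + g = 0 → g = 0)
    (n : ℕ) (hn : Odd n) (h3 : 3 ≤ n) (α β : (ZMod n)ˣ) (ι : ZMod n →+ G)
    (hι : Function.Injective ⇑ι) :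
    ∃ s : G, FS (UMultiset n α ι) = (FS (UMultiset n β ι)).map (fun x => x + s) := by
  have : NeZero n := ⟨by omega⟩
  obtain ⟨s, hs⟩ := exists_map_range_two_pow_eq (Upow_spec hn).2 α β
  refine ⟨ι s, ?_⟩
  have h := congrArg (Multiset.map ι) hs
  rw [FS_UMultiset hn, FS_UMultiset hn, Multiset.map_map]
  simpa [Multiset.map_map, Function.comp_def] using h
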